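/- arXiv:2208.02999 — 2 statements merged into one kernel-verified Lean document; each statement's English description precedes it below -/
import Mathlib

section
/- Fix integers n, m with 1 ≤ m ≤ n and real numbers p_w, p_s, p_0 with 0 ≤ p_w < p_s and 0 ≤ p_0 ≤ m·(p_s − p_w). Let 𝒢 be the collection of all m-element subsets of {1,…,n}, and for each i ∈ {1,…,n} let 𝒢_i = {G ∈ 𝒢 : i ∈ G}. Let V ⊆ ℝ be the set of all values ∑_{G ∈ 𝒢} x_G over pairs (x, p_b) with x : 𝒢 → [0,1], p_b : {1,…,n} → [0,∞), ∑_{i=1}^n p_b(i) ≤ p_0, and ∑_{G ∈ 𝒢_i} x_G ≤ p_b(i)/(p_s − p_w) for every i. Then p_0/(m·(p_s − p_w)) is the greatest element of V, i.e., it belongs to V and every element of V is at most p_0/(m·(p_s − p_w)). -/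
/-- Double counting: summing over all points the total weight of the `m`-subsets through that
point counts each `m`-subset `m` times. -/
theorem sum_sum_filter_mem_powersetCard {α R : Type*} [Fintype α] [DecidableEq α] [Semiring R]
    (m : ℕ) (x : Finset α → R) :
    ∑ i : α, ∑ G ∈ (Finset.powersetCard m (Finset.univ : Finset α)).filter (fun G => i ∈ G), x G =
      m * ∑ G ∈ Finset.powersetCard m (Finset.univ : Finset α), x G := by
  simp_rw [Finset.sum_filter]
  rw [Finset.sum_comm, Finset.mul_sum]
  refine Finset.sum_congr rfl fun G hG => ?_
  rw [← Finset.sum_filter, Finset.filter_mem_eq_inter, Finset.univ_inter, Finset.sum_const,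
    (Finset.mem_powersetCard.mp hG).2, nsmul_eq_mul]

/-- Theorem 5 (risk-neutral case), exact value: `p_0/(m·(p_s − p_w))` is the greatest value
of `∑_{G ∈ 𝒢} x_G` over all feasible pairs `(x, p_b)` with `x : 𝒢 → [0,1]`,
nonnegative bribes summing to at most `p_0 ≤ m·(p_s − p_w)`, and the per-node constraint
`∑_{G ∋ i} x_G ≤ p_b(i)/(p_s − p_w)`. -/
theorem risk_neutral_failure_probability_is_greatest
    (n m : ℕ) (hm1 : 1 ≤ m) (hmn : m ≤ n)
    (p_w p_s p_0 : ℝ) (hw : 0 ≤ p_w) (hws : p_w < p_s)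
    (hp00 : 0 ≤ p_0) (hp0m : p_0 ≤ m * (p_s - p_w)) :
    IsGreatest
      {v : ℝ | ∃ (x : Finset (Fin n) → ℝ) (p_b : Fin n → ℝ),
        (∀ G ∈ Finset.powersetCard m (Finset.univ : Finset (Fin n)),
            0 ≤ x G ∧ x G ≤ 1) ∧
        (∀ i, 0 ≤ p_b i) ∧ (∑ i, p_b i ≤ p_0) ∧
        (∀ i : Fin n,
          ∑ G ∈ (Finset.powersetCard m (Finset.univ : Finset (Fin n))).filter
              (fun G => i ∈ G), x G ≤ p_b i / (p_s - p_w)) ∧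
        v = ∑ G ∈ Finset.powersetCard m (Finset.univ : Finset (Fin n)), x G}
      (p_0 / (m * (p_s - p_w))) := by
  have hd : 0 < p_s - p_w := sub_pos.mpr hws
  have hm : (0 : ℝ) < m := by exact_mod_cast hm1
  have hmd : 0 < m * (p_s - p_w) := mul_pos hm hd
  constructor
  · obtain ⟨G₀, hG₀, hcard⟩ := Finset.exists_subset_card_eq
      (s := (Finset.univ : Finset (Fin n))) (n := m) (by simpa using hmn)
    have hmem : G₀ ∈ Finset.powersetCard m (Finset.univ : Finset (Fin n)) :=
      Finset.mem_powersetCard.mpr ⟨hG₀, hcard⟩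
    have hq0 : 0 ≤ p_0 / (m * (p_s - p_w)) := div_nonneg hp00 hmd.le
    refine ⟨fun G => if G = G₀ then p_0 / (m * (p_s - p_w)) else 0,
      fun i => if i ∈ G₀ then p_0 / m else 0, fun G _ => ?_, fun i => ?_, ?_, fun i => ?_, ?_⟩
    · dsimp only
      split_ifs
      · exact ⟨hq0, (div_le_one hmd).mpr hp0m⟩
      · exact ⟨le_rfl, zero_le_one⟩
    · dsimp only
      split_ifs
      · exact div_nonneg hp00 hm.le
      · exact le_rfl
    · rw [← Finset.sum_filter, Finset.filter_mem_eq_inter, Finset.univ_inter, Finset.sum_const,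
        hcard, nsmul_eq_mul, mul_div_cancel₀ _ hm.ne']
    · rw [Finset.sum_ite_eq']
      by_cases hi : i ∈ G₀ <;> simp [hi, hcard, div_div]
    · rw [Finset.sum_ite_eq', if_pos hmem]
  · rintro v ⟨x, p_b, -, -, hsum, hnode, rfl⟩
    rw [le_div_iff₀ hmd, ← mul_assoc, ← le_div_iff₀ hd, mul_comm,
      ← sum_sum_filter_mem_powersetCard]
    calc _ ≤ ∑ i, p_b i / (p_s - p_w) := Finset.sum_le_sum fun i _ => hnode i
      _ = (∑ i, p_b i) / (p_s - p_w) := (Finset.sum_div ..).symm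
      _ ≤ p_0 / (p_s - p_w) := by gcongr
end

section
/- Let (Ω, 𝔄, μ) be a probability space. Fix reals p_w, p_s with 0 < p_w < p_s, ν ∈ (0,1], and p_0 ≥ 0, and define f(x) = ((x + p_s)^ν − p_s^ν) / ((x + p_s)^ν − (x + p_w)^ν) for x ≥ 0. Fix integers n, m with 1 ≤ m ≤ n, let 𝒢 be the collection of all m-element subsets of {1,…,n}, and for each i let 𝒢_i = {G ∈ 𝒢 : i ∈ G}. Let (E_G)_{G ∈ 𝒢} be measurable sets, and let p_b : {1,…,n} → [0,∞) satisfy ∑_{i=1}^n p_b(i) ≤ p_0 and μ(⋃_{G ∈ 𝒢_i} E_G) ≤ f(p_b(i)) for every i. Then μ(⋃_{G ∈ 𝒢} E_G) ≤ (1/m)·f(p_0). -/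
open MeasureTheory ENNReal

/-- The slope of the chord of `t ↦ t ^ ν` from `r` to `1` is antitone in `r`, for `0 ≤ ν ≤ 1`. -/
lemma one_sub_rpow_div_one_sub_anti {ν r s : ℝ} (hν0 : 0 ≤ ν) (hν1 : ν ≤ 1)
    (hr : 0 ≤ r) (hrs : r ≤ s) (hs : s < 1) :
    (1 - s ^ ν) / (1 - s) ≤ (1 - r ^ ν) / (1 - r) := by
  have h := (Real.concaveOn_rpow hν0 hν1).neg.secant_mono (a := 1) (x := r) (y := s)
    (by simp) hr (hr.trans hrs) (by linarith) hs.ne hrs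
  simp only [Pi.neg_apply, Real.one_rpow] at h
  have e (t : ℝ) : (1 - t ^ ν) / (1 - t) = -((-t ^ ν - -1) / (t - 1)) := by
    rw [← div_neg, ← neg_sub 1 t, neg_neg]
    ring
  rw [e s, e r]
  exact neg_le_neg h

lemma one_sub_rpow_div_one_sub_pos {ν r : ℝ} (hν : 0 < ν) (hr : 0 ≤ r) (hr1 : r < 1) :
    0 < (1 - r ^ ν) / (1 - r) :=
  div_pos (sub_pos.2 (Real.rpow_lt_one hr hr1 hν)) (sub_pos.2 hr1)

lemma rpow_sub_rpow_eq {ν y b : ℝ} (hb : 0 ≤ b) (hby : b < y) :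
    y ^ ν - b ^ ν = y ^ ν / y * (y - b) * ((1 - (b / y) ^ ν) / (1 - b / y)) := by
  have hy : 0 < y := hb.trans_lt hby
  have h1 : y - b ≠ 0 := (sub_pos.2 hby).ne'
  have h2 : y ^ ν ≠ 0 := (Real.rpow_pos_of_pos hy ν).ne'
  have h3 : 1 - b / y = (y - b) / y := by field_simp
  rw [Real.div_rpow hb hy.le, h3]
  field_simp

/-- The ratio of utility differences grows at least linearly along rays from the origin. -/
lemma rpow_utility_ratio_le {p_w p_s ν x z : ℝ} (hw : 0 < p_w) (hws : p_w < p_s)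
    (hν0 : 0 < ν) (hν1 : ν ≤ 1) (hx : 0 ≤ x) (hxz : x ≤ z) (hz : 0 < z) :
    ((x + p_s) ^ ν - p_s ^ ν) / ((x + p_s) ^ ν - (x + p_w) ^ ν) ≤
      x / z * (((z + p_s) ^ ν - p_s ^ ν) / ((z + p_s) ^ ν - (z + p_w) ^ ν)) := by
  rcases hx.eq_or_lt with rfl | hx
  · simp
  have hs : 0 < p_s := hw.trans hws
  have key (t : ℝ) (ht : 0 < t) :
      ((t + p_s) ^ ν - p_s ^ ν) / ((t + p_s) ^ ν - (t + p_w) ^ ν) =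
        t / (p_s - p_w) * (((1 - (p_s / (t + p_s)) ^ ν) / (1 - p_s / (t + p_s))) /
          ((1 - ((t + p_w) / (t + p_s)) ^ ν) / (1 - (t + p_w) / (t + p_s)))) := by
    rw [rpow_sub_rpow_eq hs.le (by linarith : p_s < t + p_s),
      rpow_sub_rpow_eq (by linarith : 0 ≤ t + p_w) (by linarith : t + p_w < t + p_s)]
    have h1 : (t + p_s) ^ ν / (t + p_s) ≠ 0 := by positivity
    rw [add_sub_cancel_right, add_sub_add_left_eq_sub, mul_assoc, mul_assoc,
      mul_div_mul_left _ _ h1, mul_div_mul_comm]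
  have hd : 0 < p_s - p_w := sub_pos.2 hws
  rw [key x hx, key z hz, ← mul_assoc (x / z), div_mul_div_cancel₀ hz.ne']
  refine mul_le_mul_of_nonneg_left ?_ (by positivity)
  have hz1 : (z + p_w) / (z + p_s) < 1 := (div_lt_one (by linarith)).2 (by linarith)
  have hx1 : p_s / (x + p_s) < 1 := (div_lt_one (by linarith)).2 (by linarith)
  have hz2 : p_s / (z + p_s) < 1 := (div_lt_one (by linarith)).2 (by linarith)
  refine div_le_div₀ (one_sub_rpow_div_one_sub_pos hν0 (by positivity) hz2).le
    (one_sub_rpow_div_one_sub_anti hν0.le hν1 (by positivity) ?_ hx1)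
    (one_sub_rpow_div_one_sub_pos hν0 (by positivity) hz1)
    (one_sub_rpow_div_one_sub_anti hν0.le hν1 (by positivity) ?_ hz1)
  · gcongr
  · rw [div_le_div_iff₀ (by linarith) (by linarith)]
    nlinarith

lemma rpow_utility_ratio_nonneg {p_w p_s ν x : ℝ} (hw : 0 < p_w) (hws : p_w < p_s)
    (hν0 : 0 < ν) (hx : 0 ≤ x) :
    0 ≤ ((x + p_s) ^ ν - p_s ^ ν) / ((x + p_s) ^ ν - (x + p_w) ^ ν) :=
  div_nonneg
    (sub_nonneg.2 (Real.rpow_le_rpow (by linarith) (by linarith) hν0.le))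
    (sub_nonneg.2 (Real.rpow_le_rpow (by linarith) (by linarith) hν0.le))

/-- Double counting: a union of events indexed by `m`-element sets, weighted by `m`, is bounded by
the sum over `i` of the measures of the unions over the sets containing `i`. -/
lemma card_mul_measure_biUnion_powersetCard_le {Ω ι : Type*} [MeasurableSpace Ω] [Fintype ι]
    [DecidableEq ι] (μ : Measure Ω) (m : ℕ) (E : Finset ι → Set Ω)
    (hE : ∀ G, MeasurableSet (E G)) :
    m * μ (⋃ G ∈ Finset.powersetCard m (Finset.univ : Finset ι), E G) ≤
      ∑ i, μ (⋃ G ∈ (Finset.powersetCard m (Finset.univ : Finset ι)).filter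
        (fun G => i ∈ G), E G) := by
  set U := ⋃ G ∈ Finset.powersetCard m (Finset.univ : Finset ι), E G
  set A : ι → Set Ω := fun i => ⋃ G ∈ (Finset.powersetCard m (Finset.univ : Finset ι)).filter
    (fun G => i ∈ G), E G
  have hUm : MeasurableSet U := Finset.measurableSet_biUnion _ fun G _ => hE G
  have hAm (i : ι) : MeasurableSet (A i) := Finset.measurableSet_biUnion _ fun G _ => hE G
  calc m * μ U = ∫⁻ ω, U.indicator (fun _ => (m : ℝ≥0∞)) ω ∂μ := by
        rw [lintegral_indicator_const hUm]
    _ ≤ ∫⁻ ω, ∑ i, (A i).indicator 1 ω ∂μ := by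
        refine lintegral_mono fun ω => ?_
        by_cases hω : ω ∈ U
        swap
        · simp [hω]
        rw [Set.indicator_of_mem hω]
        obtain ⟨G, hG, hωG⟩ := Set.mem_iUnion₂.1 hω
        calc (m : ℝ≥0∞) = ∑ i ∈ G, 1 := by simp [(Finset.mem_powersetCard.1 hG).2]
          _ ≤ ∑ i ∈ G, (A i).indicator 1 ω := by
            refine Finset.sum_le_sum fun i hi => ?_
            have : ω ∈ A i := Set.mem_iUnion₂.2 ⟨G, Finset.mem_filter.2 ⟨hG, hi⟩, hωG⟩
            simp [this]
          _ ≤ ∑ i, (A i).indicator 1 ω :=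
            Finset.sum_le_sum_of_subset (Finset.subset_univ G)
    _ = ∑ i, μ (A i) := by
        rw [lintegral_finsetSum _ fun i _ => measurable_one.indicator (hAm i)]
        exact Finset.sum_congr rfl fun i _ => lintegral_indicator_one (hAm i)

/-- Probabilistic form of the upper bound of Theorem 10 (risk-averse case): with
`f(x) = ((x + p_s)^ν − p_s^ν)/((x + p_s)^ν − (x + p_w)^ν)`, if each event `⋃_{G ∋ i} E_G`
has probability at most `f(p_b(i))` for nonnegative bribes summing to at most `p_0`, then
`μ(⋃_G E_G) ≤ (1/m)·f(p_0)`. -/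
theorem risk_averse_failure_event_probability_bound {Ω : Type*} [MeasurableSpace Ω]
    (μ : Measure Ω) [IsProbabilityMeasure μ]
    (p_w p_s ν p_0 : ℝ) (hw : 0 < p_w) (hws : p_w < p_s)
    (hν0 : 0 < ν) (hν1 : ν ≤ 1) (hp0 : 0 ≤ p_0)
    (f : ℝ → ℝ)
    (hf : ∀ x : ℝ, 0 ≤ x →
      f x = ((x + p_s) ^ ν - p_s ^ ν) / ((x + p_s) ^ ν - (x + p_w) ^ ν))
    (n m : ℕ) (hm1 : 1 ≤ m) (hmn : m ≤ n)
    (E : Finset (Fin n) → Set Ω) (hE : ∀ G, MeasurableSet (E G))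
    (p_b : Fin n → ℝ) (hpb : ∀ i, 0 ≤ p_b i) (hsum : ∑ i, p_b i ≤ p_0)
    (hcon : ∀ i : Fin n,
      μ (⋃ G ∈ (Finset.powersetCard m (Finset.univ : Finset (Fin n))).filter
          (fun G => i ∈ G), E G) ≤ ENNReal.ofReal (f (p_b i))) :
    μ (⋃ G ∈ Finset.powersetCard m (Finset.univ : Finset (Fin n)), E G)
      ≤ ENNReal.ofReal ((1 / m) * f p_0) := by
  have hf0 (x : ℝ) (hx : 0 ≤ x) : 0 ≤ f x := by
    rw [hf x hx]
    exact rpow_utility_ratio_nonneg hw hws hν0 hx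
  have hle (i : Fin n) : p_b i ≤ p_0 :=
    (Finset.single_le_sum (fun j _ => hpb j) (Finset.mem_univ i)).trans hsum
  have hfsum : ∑ i, f (p_b i) ≤ f p_0 := by
    rcases hp0.eq_or_lt with h0 | hpos
    · have hz (i : Fin n) : f (p_b i) = 0 := by
        rw [le_antisymm ((hle i).trans h0.ge) (hpb i), hf 0 le_rfl]
        simp
      simpa [hz] using hf0 p_0 hp0
    · calc ∑ i, f (p_b i) ≤ ∑ i, p_b i / p_0 * f p_0 := by
            refine Finset.sum_le_sum fun i _ => ?_
            rw [hf _ (hpb i), hf _ hp0]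
            exact rpow_utility_ratio_le hw hws hν0 hν1 (hpb i) (hle i) hpos
        _ = (∑ i, p_b i) / p_0 * f p_0 := by rw [← Finset.sum_mul, Finset.sum_div]
        _ ≤ f p_0 := mul_le_of_le_one_left (hf0 p_0 hp0) ((div_le_one hpos).2 hsum)
  have hm : (0 : ℝ) < m := by exact_mod_cast hm1
  have hcount := (card_mul_measure_biUnion_powersetCard_le μ m E hE).trans
    (Finset.sum_le_sum fun i _ => hcon i)
  rw [← ENNReal.ofReal_sum_of_nonneg fun i _ => hf0 _ (hpb i)] at hcount
  rw [one_div_mul_eq_div, ENNReal.ofReal_div_of_pos hm, ENNReal.ofReal_natCast,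
    ENNReal.le_div_iff_mul_le (by simp; omega) (by simp), mul_comm]
  exact hcount.trans (ENNReal.ofReal_le_ofReal hfsum)
end
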